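/- For every s in the open interval (0, π/2), one has (8s^4 + 46s^2 − 25) + G(s)·(32s^3 − 100s) ≤ 0. -/

import Mathlib

/-- `G(s) = (1/2)·((√(1+sin s) + √(1−sin s))/(√(1+sin s) − √(1−sin s)) + tan s)`. -/
noncomputable def G (s : ℝ) : ℝ :=
  (1 / 2) * ((Real.sqrt (1 + Real.sin s) + Real.sqrt (1 - Real.sin s)) /
      (Real.sqrt (1 + Real.sin s) - Real.sqrt (1 - Real.sin s)) + Real.tan s)

lemma G_eq {s : ℝ} (hs : s ∈ Set.Ioo (0 : ℝ) (Real.pi / 2)) :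
    G s = (1 + Real.cos s) / (2 * Real.sin s * Real.cos s) := by
  obtain ⟨h0, h1⟩ := hs
  have hc : 0 < Real.cos s := Real.cos_pos_of_mem_Ioo ⟨by linarith, h1⟩
  have hx : 0 < Real.sin (s / 2) := Real.sin_pos_of_pos_of_lt_pi (by linarith) (by linarith)
  have hy : 0 < Real.cos (s / 2) := Real.cos_pos_of_mem_Ioo ⟨by linarith, by linarith⟩
  have hsin : Real.sin s = 2 * Real.sin (s / 2) * Real.cos (s / 2) := by
    rw [← Real.sin_two_mul]; ring_nf
  have hcos : Real.cos s = 2 * Real.cos (s / 2) ^ 2 - 1 := by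
    rw [← Real.cos_two_mul]; ring_nf
  have hsq := Real.sin_sq_add_cos_sq (s / 2)
  have hlt : Real.sin (s / 2) < Real.cos (s / 2) := by nlinarith
  have hplus : Real.sqrt (1 + Real.sin s) = Real.cos (s / 2) + Real.sin (s / 2) := by
    rw [Real.sqrt_eq_iff_mul_self_eq] <;> nlinarith
  have hminus : Real.sqrt (1 - Real.sin s) = Real.cos (s / 2) - Real.sin (s / 2) := by
    rw [Real.sqrt_eq_iff_mul_self_eq] <;> nlinarith
  rw [G, hplus, hminus, Real.tan_eq_sin_div_cos]
  have hratio : (Real.cos (s / 2) + Real.sin (s / 2) + (Real.cos (s / 2) - Real.sin (s / 2))) /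
      (Real.cos (s / 2) + Real.sin (s / 2) - (Real.cos (s / 2) - Real.sin (s / 2))) =
      Real.cos (s / 2) / Real.sin (s / 2) := by
    rw [div_eq_div_iff (by linarith) hx.ne']; ring
  rw [hratio, hsin]
  have hsq' : Real.sin (s / 2) ^ 2 = (1 - Real.cos s) / 2 := by linarith
  have hcq' : Real.cos (s / 2) ^ 2 = (1 + Real.cos s) / 2 := by linarith
  field_simp
  rw [hsq', hcq']
  ring

/-- For every `s ∈ (0, π/2)`, `(8s⁴ + 46s² − 25) + G(s)·(32s³ − 100s) ≤ 0`. -/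
theorem stmt_1 :
    ∀ s ∈ Set.Ioo (0 : ℝ) (Real.pi / 2),
      (8 * s ^ 4 + 46 * s ^ 2 - 25) + G s * (32 * s ^ 3 - 100 * s) ≤ 0 := by
  intro s hs
  rw [G_eq hs]
  obtain ⟨h0, h1⟩ := hs
  have hpi := Real.pi_lt_d4
  have hc : 0 < Real.cos s := Real.cos_pos_of_mem_Ioo ⟨by linarith, h1⟩
  have hsin : 0 < Real.sin s := Real.sin_pos_of_pos_of_lt_pi h0 (by linarith)
  have hcle : Real.cos s ≤ 1.5708 - s := by
    have := Real.sin_le (x := Real.pi / 2 - s) (by linarith)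
    rw [Real.sin_pi_div_two_sub] at this
    linarith
  have hA : 0 < 2 * s * (25 - 8 * s ^ 2) := by
    have : 0 < 25 - 8 * s ^ 2 := by nlinarith
    positivity
  have key : (8 * s ^ 4 + 46 * s ^ 2 - 25) * (Real.sin s * Real.cos s) ≤
      2 * s * (25 - 8 * s ^ 2) * (1 + Real.cos s) := by
    have hAc := mul_pos hA hc
    have hsc := mul_pos hsin hc
    rcases le_or_gt (8 * s ^ 4 + 46 * s ^ 2 - 25) 0 with hP | hP
    · nlinarith [mul_nonneg (neg_nonneg.2 hP) hsc.le]
    · have hsc_le : Real.sin s * Real.cos s ≤ 1.5708 - s :=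
        (mul_le_of_le_one_left hc.le (Real.sin_le_one s)).trans hcle
      have hpoly : (8 * s ^ 4 + 46 * s ^ 2 - 25) * (1.5708 - s) ≤
          2 * s * (25 - 8 * s ^ 2) := by
        have hd : 0 ≤ 1.5708 - s := by linarith
        nlinarith [mul_nonneg h0.le hd, mul_nonneg (mul_nonneg h0.le hd) (sq_nonneg (s - 1)),
          mul_nonneg h0.le (sq_nonneg (s ^ 2 - 1)), mul_nonneg hd (sq_nonneg (s - 1)),
          mul_nonneg h0.le (sq_nonneg (s - 1))]
      linarith [mul_le_mul_of_nonneg_left hsc_le hP.le]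
  have hrw : (8 * s ^ 4 + 46 * s ^ 2 - 25) +
      (1 + Real.cos s) / (2 * Real.sin s * Real.cos s) * (32 * s ^ 3 - 100 * s) =
      ((8 * s ^ 4 + 46 * s ^ 2 - 25) * (Real.sin s * Real.cos s) -
        2 * s * (25 - 8 * s ^ 2) * (1 + Real.cos s)) / (Real.sin s * Real.cos s) := by
    field_simp
    ring
  rw [hrw]
  exact div_nonpos_of_nonpos_of_nonneg (by linarith) (by positivity)
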